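/- Let N > 1 be an integer, w ≥ 2 an even integer, m an integer with 0 ≤ m ≤ w, and n an integer with 0 < n < w, ñ = w − n. Then r_m(R_{N,w,n}) = (−N)^{ñ−m} · r_{w−m}(R_{N,w,ñ}). -/

import Mathlib

open MeasureTheory

noncomputable section

/-- The constant `c_{w,n} = (-1)^n · 2πi · C(w,n)`. -/
def cwn (w n : ℕ) : ℂ := (-1) ^ n * (2 * (Real.pi : ℂ) * Complex.I) * (w.choose n : ℂ)

/-- The Poincaré-type series `R_{N,w,n}`, viewed as a function on `ℂ`. -/
def RG (N w n : ℕ) (z : ℂ) : ℂ :=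
  (cwn w n)⁻¹ * ∑' γ : CongruenceSubgroup.Gamma0 N,
    ((γ.1.1 0 0 : ℂ) * z + (γ.1.1 0 1 : ℂ)) ^ (-((w : ℤ) - n + 1)) *
      ((γ.1.1 1 0 : ℂ) * z + (γ.1.1 1 1 : ℂ)) ^ (-((n : ℤ) + 1))

/-- The `m`-th period `r_m(f) = ∫₀^{i∞} f(z) z^m dz`, parametrized by `z = it`. -/
def periodN (m : ℕ) (f : ℂ → ℂ) : ℂ :=
  ∫ t in Set.Ioi (0 : ℝ), f (Complex.I * t) * (Complex.I * t) ^ m * Complex.I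

/-- The Atkin-Lehner conjugation `[a,b;c,d] ↦ [d,-c/N;-Nb,a]` of `Γ₀(N)`. -/
def alFun (N : ℕ) (γ : CongruenceSubgroup.Gamma0 N) : CongruenceSubgroup.Gamma0 N :=
  ⟨⟨!![γ.1.1 1 1, -(γ.1.1 1 0 / N); -(N * γ.1.1 0 1), γ.1.1 0 0], by
    have h1 : (N : ℤ) ∣ γ.1.1 1 0 := by
      have := γ.2
      rw [CongruenceSubgroup.Gamma0_mem] at this
      exact (ZMod.intCast_zmod_eq_zero_iff_dvd _ _).1 this
    have h2 := γ.1.2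
    rw [Matrix.det_fin_two] at h2
    rw [Matrix.det_fin_two_of]
    have h3 := Int.ediv_mul_cancel h1
    linear_combination h2 - γ.1.1 0 1 * h3⟩, 
    CongruenceSubgroup.Gamma0_mem.2 (by simp)⟩

lemma gamma0_dvd (N : ℕ) (γ : CongruenceSubgroup.Gamma0 N) : (N : ℤ) ∣ γ.1.1 1 0 := by
  have := γ.2
  rw [CongruenceSubgroup.Gamma0_mem] at this
  exact (ZMod.intCast_zmod_eq_zero_iff_dvd _ _).1 this

lemma alFun_invol (N : ℕ) (hN : 1 < N) : Function.Involutive (alFun N) := by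
  intro γ
  have h3 := Int.mul_ediv_cancel' (gamma0_dvd N γ)
  have hN' : (N : ℤ) ≠ 0 := by exact_mod_cast (by omega : N ≠ 0)
  apply Subtype.ext
  apply Subtype.ext
  ext i j
  fin_cases i <;> fin_cases j
  · simp [alFun]
  · simp only [alFun]
    simp [neg_mul_eq_mul_neg, -mul_neg, Int.mul_ediv_cancel_left _ hN']
  · simp [alFun, h3]
  · simp [alFun]

lemma RG_al (N n k : ℕ) (hN : 1 < N) (hwe : Even (n + k)) (u : ℂ) (hu : u ≠ 0) :
    RG N (n + k) n (-1 / (N * u)) =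
      (-(N : ℂ)) ^ (k + 1) * u ^ (n + k + 2) * RG N (n + k) k u := by
  have hN' : (N : ℂ) ≠ 0 := by exact_mod_cast (by omega : N ≠ 0)
  have hc : cwn (n + k) n = cwn (n + k) k := by
    unfold cwn
    have h1 : ((-1 : ℂ)) ^ n = (-1) ^ k := by
      have h2 : Even n ↔ Even k := Nat.even_add.1 hwe
      by_cases h : Even n
      · rw [h.neg_one_pow, (h2.1 h).neg_one_pow]
      · rw [(Nat.not_even_iff_odd.1 h).neg_one_pow,
          (Nat.not_even_iff_odd.1 (fun h' => h (h2.2 h'))).neg_one_pow]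
    rw [h1, Nat.choose_symm_add]
  unfold RG
  rw [hc, mul_left_comm]
  congr 1
  rw [← (alFun_invol N hN).toPerm.tsum_eq, ← tsum_mul_left]
  apply tsum_congr
  intro γ
  have h3 := Int.mul_ediv_cancel' (gamma0_dvd N γ)
  set q := γ.1.1 1 0 / (N : ℤ) with hq
  have e1 : -(((n + k : ℕ) : ℤ) - n + 1) = -((k + 1 : ℕ) : ℤ) := by push_cast; ring
  have e2 : -(((n + k : ℕ) : ℤ) - k + 1) = -((n + 1 : ℕ) : ℤ) := by push_cast; ring
  have e3 : -((n : ℤ) + 1) = -((n + 1 : ℕ) : ℤ) := by push_cast; ring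
  have e4 : -((k : ℤ) + 1) = -((k + 1 : ℕ) : ℤ) := by push_cast; ring
  rw [e1, e2, e3, e4]
  simp only [zpow_neg, zpow_natCast]
  simp only [Function.Involutive.coe_toPerm, alFun]
  simp only [Matrix.of_apply, Matrix.cons_val', Matrix.cons_val_zero, Matrix.cons_val_one,
    Matrix.cons_val_fin_one]
  rw [← h3]
  simp only [Int.mul_ediv_cancel_left _ (by exact_mod_cast hN' : (N : ℤ) ≠ 0)]
  push_cast
  have a1 : (γ.1.1 1 1 : ℂ) * (-1 / (N * u)) + -(q : ℂ) =
      (N * q * u + γ.1.1 1 1) / (-(N * u)) := by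
    field_simp
    ring
  have a2 : -((N : ℂ) * (γ.1.1 0 1 : ℂ)) * (-1 / (N * u)) + (γ.1.1 0 0 : ℂ) =
      ((γ.1.1 0 0 : ℂ) * u + γ.1.1 0 1) / u := by
    field_simp
    ring
  rw [a1, a2, div_pow, div_pow, inv_div, inv_div, div_eq_mul_inv, div_eq_mul_inv, neg_mul_eq_neg_mul,
    mul_pow]
  ring

theorem period_atkin_lehner (N w m n : ℕ) (hN : 1 < N) (hw : 2 ≤ w) (hwe : Even w)
    (hmw : m ≤ w) (hn : 0 < n) (hnw : n < w) :
    periodN m (RG N w n) =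
      (-(N : ℂ)) ^ ((w : ℤ) - n - m) * periodN (w - m) (RG N w (w - n)) := by
  obtain ⟨k, rfl⟩ := Nat.exists_eq_add_of_lt hnw
  rw [show n + k + 1 = n + (k + 1) by ring] at *
  generalize k + 1 = k at *
  obtain ⟨l, hl⟩ := Nat.exists_eq_add_of_le hmw
  have hN' : (N : ℂ) ≠ 0 := by exact_mod_cast (by omega : N ≠ 0)
  have hNr : (0 : ℝ) < N := by exact_mod_cast (by omega : 0 < N)
  rw [show n + k - m = l by omega, show n + k - n = k by omega,
    show (((n + k : ℕ) : ℤ) - n - m) = (k : ℤ) - m by push_cast; ring,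
    zpow_sub₀ (neg_ne_zero.2 hN'), zpow_natCast, zpow_natCast]
  unfold periodN
  set g : ℝ → ℂ := fun t => RG N (n + k) n (Complex.I * t) * (Complex.I * t) ^ m * Complex.I with hg
  have s1 := integral_comp_rpow_Ioi g (p := -1) (by norm_num)
  have s2 := integral_comp_mul_left_Ioi
    (fun x : ℝ => (|(-1 : ℝ)| * x ^ ((-1 : ℝ) - 1)) • g (x ^ (-1 : ℝ))) 0 hNr
  rw [mul_zero, s1, eq_inv_smul_iff₀ hNr.ne'] at s2
  rw [← s2, ← integral_smul, ← integral_const_mul]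
  apply setIntegral_congr_fun measurableSet_Ioi
  intro s hs
  have hs : 0 < s := hs
  have hs' : (s : ℂ) ≠ 0 := by exact_mod_cast hs.ne'
  have hns : 0 < N * s := by positivity
  have r1 : (N * s) ^ ((-1 : ℝ) - 1) = ((N * s) ^ 2)⁻¹ := by
    rw [show (-1 : ℝ) - 1 = -((2 : ℕ) : ℝ) by norm_num, Real.rpow_neg hns.le, Real.rpow_natCast]
  have hI : Complex.I * s ≠ 0 := mul_ne_zero Complex.I_ne_zero hs'
  have r2 : Complex.I * ((((N : ℝ) * s)⁻¹ : ℝ) : ℂ) = -1 / (N * (Complex.I * s)) := by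
    push_cast
    field_simp
    simp
  simp only [hg, Real.rpow_neg_one, r1, abs_neg, abs_one, one_mul, Complex.real_smul]
  rw [r2, RG_al N n k hN hwe _ hI]
  have r3 : ((((((N : ℝ) * s) ^ 2)⁻¹ : ℝ)) : ℂ) = -1 / ((N : ℂ) * (Complex.I * s)) ^ 2 := by
    push_cast
    rw [mul_pow, mul_pow, mul_pow, Complex.I_sq]
    field_simp
  rw [r3]
  generalize Complex.I * (s : ℂ) = u at hI ⊢
  rw [show n + k + 2 = m + l + 2 by omega, pow_succ (-(N : ℂ)) k, pow_add, pow_add,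
    show -1 / ((N : ℂ) * u) = 1 / (-(N : ℂ) * u) by field_simp, div_pow, mul_pow _ u m, one_pow]
  have hNm : (-(N : ℂ)) ^ m ≠ 0 := pow_ne_zero _ (neg_ne_zero.2 hN')
  generalize (-(N : ℂ)) ^ m = A at hNm ⊢
  generalize (-(N : ℂ)) ^ k = B
  push_cast
  field_simp
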